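/- arXiv:2205.09274 — 5 statements merged into one kernel-verified Lean document; each statement's English description precedes it below -/
import Mathlib

section
/- Let (A^{p,q}, ∂, ∂̄) be a bounded double complex of complex vector spaces satisfying the ∂∂̄-lemma. Then for every k the natural map ⊕_{p+q=k} H^{p,q}_{BC}(A) → H^k_d(A), sending each Bott–Chern class to its de Rham class and summing, is an isomorphism of complex vector spaces; in particular H^k_d(A) = ⊕_{p+q=k} Image(H^{p,q}_{BC}(A) → H^k_d(A)) is a direct sum decomposition. -/
/-!
STATEMENT 3: For a bounded double complex `(A^{p,q}, ∂, ∂̄)` of complex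
vector spaces satisfying the ∂∂̄-lemma, for every `k` the natural map
`⊕_{p+q=k} H^{p,q}_{BC}(A) → H^k_d(A)` is an isomorphism; in particular
`H^k_d(A) = ⊕_{p+q=k} Image(H^{p,q}_{BC}(A) → H^k_d(A))` is an internal
direct sum decomposition.

Formalization: injectivity is expressed at the level of representatives
(a family of Bott–Chern classes of pure bidegrees summing to a d-exact
element must have each member ∂∂̄-exact), and the decomposition is expressed
as `DirectSum.IsInternal` of the family of images inside the de Rham
cohomology `H^k_d(A)`, realized as the quotient of `ker d ∩ A^k` by
`im d ∩ A^k`.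
-/

open LinearMap Submodule

/-- A bounded double complex of complex vector spaces, realized as a bigraded
family of subspaces `A (p, q)` of an ambient space `V` (whose internal direct
sum is `V`), with anticommuting square-zero operators `D = ∂` of bidegree
`(1,0)` and `Db = ∂̄` of bidegree `(0,1)`, and only finitely many nonzero
pieces. -/
structure IsBoundedDoubleComplex {V : Type*} [AddCommGroup V] [Module ℂ V]
    (A : ℤ × ℤ → Submodule ℂ V) (D Db : V →ₗ[ℂ] V) : Prop where
  internal : DirectSum.IsInternal A
  bounded : {pq : ℤ × ℤ | A pq ≠ ⊥}.Finite
  mapD : ∀ p q : ℤ, Submodule.map D (A (p, q)) ≤ A (p + 1, q)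
  mapDb : ∀ p q : ℤ, Submodule.map Db (A (p, q)) ≤ A (p, q + 1)
  ddzero : D ∘ₗ D = 0
  dbdbzero : Db ∘ₗ Db = 0
  anticomm : D ∘ₗ Db + Db ∘ₗ D = 0

variable {V : Type*} [AddCommGroup V] [Module ℂ V]

/-- The total-degree-`k` part `A^k = ⊕_{p+q=k} A^{p,q}`. -/
def Ak (A : ℤ × ℤ → Submodule ℂ V) (k : ℤ) : Submodule ℂ V :=
  ⨆ r : ℤ, A (r, k - r)

/-- The `d`-closed elements of total degree `k`: `ker d ∩ A^k`. -/
def Zd (A : ℤ × ℤ → Submodule ℂ V) (D Db : V →ₗ[ℂ] V) (k : ℤ) : Submodule ℂ V :=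
  ker (D + Db) ⊓ Ak A k

/-- The `d`-exact elements of total degree `k`, viewed inside `Zd`:
`im d ∩ A^k` pulled back to the subspace `ker d ∩ A^k`. -/
abbrev BdZ (A : ℤ × ℤ → Submodule ℂ V) (D Db : V →ₗ[ℂ] V) (k : ℤ) :
    Submodule ℂ ↥(Zd A D Db k) :=
  (range (D + Db) ⊓ Ak A k).comap (Zd A D Db k).subtype

/-- The degree-`k` de Rham cohomology `H^k_d(A) = (ker d ∩ A^k)/(im d ∩ A^k)`. -/
abbrev Hd (A : ℤ × ℤ → Submodule ℂ V) (D Db : V →ₗ[ℂ] V) (k : ℤ) :=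
  ↥(Zd A D Db k) ⧸ BdZ A D Db k

/-- The image of `H^{r,k-r}_{BC}(A)` in `H^k_d(A)`: the subspace of classes
represented by `d`-closed elements of `ker ∂ ∩ ker ∂̄ ∩ A^{r,k-r}`. -/
def bcImage (A : ℤ × ℤ → Submodule ℂ V) (D Db : V →ₗ[ℂ] V) (k r : ℤ) :
    Submodule ℂ (Hd A D Db k) :=
  Submodule.map (BdZ A D Db k).mkQ
    ((ker D ⊓ ker Db ⊓ A (r, k - r)).comap (Zd A D Db k).subtype)


section BCHelpers

/-- Existence of the bigraded projections. -/
lemma bc_exists_proj {A : ℤ × ℤ → Submodule ℂ V} (h : DirectSum.IsInternal A) :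
    ∃ P : ℤ × ℤ → V →ₗ[ℂ] V, (∀ i x, P i x ∈ A i) ∧ (∀ i x, x ∈ A i → P i x = x) ∧
      (∀ i j x, x ∈ A j → j ≠ i → P i x = 0) := by
  classical
  let e := LinearEquiv.ofBijective (DirectSum.coeLinearMap A) h
  have he : ∀ j (x : A j), e.symm (x : V) = DirectSum.lof ℂ (ℤ × ℤ) (fun i => A i) j x := by
    intro j x
    rw [LinearEquiv.symm_apply_eq]
    exact (DirectSum.coeLinearMap_lof A j x).symm
  refine ⟨fun i => (A i).subtype ∘ₗ DirectSum.component ℂ (ℤ × ℤ) (fun i => A i) i ∘ₗ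
    e.symm.toLinearMap, ?_, ?_, ?_⟩
  · intro i x
    simp
  · intro i x hx
    have := he i ⟨x, hx⟩
    simp only [LinearMap.comp_apply, LinearEquiv.coe_coe] at this ⊢
    rw [this, DirectSum.component.lof_self]
    rfl
  · intro i j x hx hij
    have := he j ⟨x, hx⟩
    simp only [LinearMap.comp_apply, LinearEquiv.coe_coe] at this ⊢
    rw [this, DirectSum.component.of, dif_neg hij]
    simp

/-- A homogeneous operator commutes with the projections. -/
lemma bc_comm {A : ℤ × ℤ → Submodule ℂ V} (h : DirectSum.IsInternal A)
    {P : ℤ × ℤ → V →ₗ[ℂ] V} (hP1 : ∀ i x, x ∈ A i → P i x = x)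
    (hP0 : ∀ i j x, x ∈ A j → j ≠ i → P i x = 0)
    (T : V →ₗ[ℂ] V) (s : ℤ × ℤ) (hT : ∀ i x, x ∈ A i → T x ∈ A (i + s))
    (i : ℤ × ℤ) (x : V) : P (i + s) (T x) = T (P i x) := by
  have hx : x ∈ iSup A := by rw [h.submodule_iSup_eq_top]; trivial
  induction hx using Submodule.iSup_induction' with
  | mem j x hx =>
    by_cases hij : j = i
    · subst hij
      rw [hP1 _ _ (hT _ _ hx), hP1 _ _ hx]
    · rw [hP0 _ _ _ (hT _ _ hx) (fun hh => hij (add_right_cancel hh)), hP0 _ _ _ hx hij, map_zero]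
  | zero => simp
  | add x y _ _ hx hy => simp [hx, hy]

lemma bc_sum {A : ℤ × ℤ → Submodule ℂ V}
    {P : ℤ × ℤ → V →ₗ[ℂ] V} (hP1 : ∀ i x, x ∈ A i → P i x = x)
    (hP0 : ∀ i j x, x ∈ A j → j ≠ i → P i x = 0)
    (S : Finset ℤ) (hS : ∀ p q, p ∉ S → A (p, q) = ⊥) (k : ℤ) (x : V) (hx : x ∈ Ak A k) :
    ∑ r ∈ S, P (r, k - r) x = x := by
  unfold Ak at hx
  induction hx using Submodule.iSup_induction' with
  | mem j x hx =>
    by_cases hj : j ∈ S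
    · rw [Finset.sum_eq_single j, hP1 _ _ hx]
      · intro b _ hb
        exact hP0 _ _ _ hx (fun hh => hb (congrArg Prod.fst hh).symm)
      · exact fun hh => absurd hj hh
    · rw [hS _ _ hj, Submodule.mem_bot] at hx
      simp [hx]
  | zero => simp
  | add x y _ _ hx hy => simp [Finset.sum_add_distrib, hx, hy]

end BCHelpers

theorem bc_hodge_decomposition
    (A : ℤ × ℤ → Submodule ℂ V) (D Db : V →ₗ[ℂ] V)
    (hc : IsBoundedDoubleComplex A D Db)
    (hlem : ker D ⊓ ker Db ⊓ (range D ⊔ range Db) = range (D ∘ₗ Db))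
    (k : ℤ) :
    (∀ β : ℤ → V, (∀ r, β r ∈ ker D ⊓ ker Db ⊓ A (r, k - r)) →
        (∑ᶠ r : ℤ, β r) ∈ range (D + Db) → ∀ r, β r ∈ range (D ∘ₗ Db)) ∧
    DirectSum.IsInternal (fun r : ℤ => bcImage A D Db k r) := by
  classical
  obtain ⟨P, hPm, hP1, hP0⟩ := bc_exists_proj hc.internal
  have hDm : ∀ i x, x ∈ A i → D x ∈ A (i + (1, 0)) := by
    rintro ⟨p, q⟩ x hx
    simpa using hc.mapD p q (Submodule.mem_map_of_mem hx)
  have hDbm : ∀ i x, x ∈ A i → Db x ∈ A (i + (0, 1)) := by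
    rintro ⟨p, q⟩ x hx
    simpa using hc.mapDb p q (Submodule.mem_map_of_mem hx)
  have cD : ∀ p q x, P (p, q) (D x) = D (P (p - 1, q) x) := by
    intro p q x
    simpa using bc_comm hc.internal hP1 hP0 D (1, 0) hDm (p - 1, q) x
  have cDb : ∀ p q x, P (p, q) (Db x) = Db (P (p, q - 1) x) := by
    intro p q x
    simpa using bc_comm hc.internal hP1 hP0 Db (0, 1) hDbm (p, q - 1) x
  have hDD : ∀ x, D (D x) = 0 := fun x => LinearMap.congr_fun hc.ddzero x
  have hBB : ∀ x, Db (Db x) = 0 := fun x => LinearMap.congr_fun hc.dbdbzero x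
  have hDB : ∀ x, Db (D x) = - D (Db x) := fun x =>
    eq_neg_of_add_eq_zero_right (LinearMap.congr_fun hc.anticomm x)
  obtain ⟨S, hS⟩ : ∃ S : Finset ℤ, ∀ p q, p ∉ S → A (p, q) = ⊥ := by
    refine ⟨hc.bounded.toFinset.image Prod.fst, fun p q hp => ?_⟩
    by_contra hne
    exact hp (Finset.mem_image.2 ⟨(p, q), by simpa using hne, rfl⟩)
  -- components of exact elements
  have key : ∀ r x a, a ∈ ker D ⊓ ker Db → x ∈ range (D + Db) → P (r, k - r) x = a →
      a ∈ range (D ∘ₗ Db) := by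
    rintro r _ a ha ⟨y, rfl⟩ rfl
    rw [← hlem]
    refine ⟨ha, ?_⟩
    rw [LinearMap.add_apply, map_add, cD, cDb]
    exact Submodule.add_mem_sup ⟨_, rfl⟩ ⟨_, rfl⟩
  have hex : ∀ a, a ∈ range (D ∘ₗ Db) → a ∈ range (D + Db) := by
    rintro _ ⟨y, rfl⟩
    exact ⟨Db y, by simp [hBB]⟩
  have hAk : ∀ k r x, x ∈ A (r, k - r) → x ∈ Ak A k := fun k r x hx =>
    Submodule.mem_iSup_of_mem (p := fun r => A (r, k - r)) r hx
  refine ⟨?_, ?_⟩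
  · intro β hβ hsum r
    refine key r _ _ (hβ r).1 hsum ?_
    have h1 : ∑ᶠ r, β r = ∑ r ∈ S, β r := by
      apply finsum_eq_sum_of_support_subset
      intro s hs
      by_contra hsS
      have : β s ∈ A (s, k - s) := (hβ s).2
      rw [hS _ _ (by simpa using hsS), Submodule.mem_bot] at this
      exact hs this
    have h2 : ∑ᶠ r, β r ∈ Ak A k := by
      rw [h1]
      exact Submodule.sum_mem _ fun s _ => hAk k s _ (hβ s).2
    rw [h1, map_sum]
    by_cases hr : r ∈ S
    · rw [Finset.sum_eq_single r, hP1 _ _ (hβ r).2]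
      · intro b _ hb
        exact hP0 _ _ _ (hβ b).2 (fun hh => hb (congrArg Prod.fst hh))
      · exact fun hh => absurd hr hh
    · have : β r ∈ A (r, k - r) := (hβ r).2
      rw [hS _ _ hr, Submodule.mem_bot] at this
      rw [this]
      have := hPm (r, k - r) (∑ s ∈ S, β s)
      rw [hS _ _ hr, Submodule.mem_bot, map_sum] at this
      exact this
  · apply DirectSum.isInternal_submodule_of_iSupIndep_of_iSup_eq_top
    · intro r
      rw [Submodule.disjoint_def]
      intro x hx1 hx2
      have hle : (⨆ j, ⨆ (_ : j ≠ r), bcImage A D Db k j) ≤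
          Submodule.map (BdZ A D Db k).mkQ
            ((ker (P (r, k - r))).comap (Zd A D Db k).subtype) := by
        refine iSup₂_le fun j hj => Submodule.map_mono (Submodule.comap_mono ?_)
        intro y hy
        exact hP0 _ _ _ hy.2 (fun hh => hj (congrArg Prod.fst hh))
      obtain ⟨z, hz, hzx⟩ := hle hx2
      obtain ⟨a, ha, rfl⟩ := hx1
      have hd := (Submodule.Quotient.eq _).1 hzx.symm
      rw [Submodule.mkQ_apply, Submodule.Quotient.mk_eq_zero]
      refine ⟨hex _ (key r _ _ ha.1 hd.1 ?_), a.2.2⟩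
      have hz' : P (r, k - r) (z : V) = 0 := hz
      have ha' : P (r, k - r) (a : V) = a := hP1 _ _ ha.2
      simp only [Submodule.subtype_apply, Submodule.coe_sub, map_sub]
      rw [hz', ha', sub_zero]
    · rw [eq_top_iff]
      rintro x -
      obtain ⟨⟨α, hα⟩, rfl⟩ := (BdZ A D Db k).mkQ_surjective x
      have hαd : D α + Db α = 0 := hα.1
      have hcl : ∀ r, D (P (r - 1, k - (r - 1)) α) + Db (P (r, k - r) α) = 0 := by
        intro r
        have := congrArg (P (r, k - r + 1)) hαd
        rw [map_add, cD, cDb, map_zero] at this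
        convert this using 5 <;> ring_nf
      have hγ : ∀ r, ∃ g ∈ A (r, k - 1 - r), D (Db g) = D (P (r, k - r) α) := by
        intro r
        have hm : D (P (r, k - r) α) ∈ range (D ∘ₗ Db) := by
          rw [← hlem]
          refine ⟨⟨hDD _, ?_⟩, Submodule.mem_sup_left ⟨_, rfl⟩⟩
          have := hcl (r + 1)
          rw [add_sub_cancel_right] at this
          rw [SetLike.mem_coe, LinearMap.mem_ker, eq_neg_of_add_eq_zero_left this, map_neg, hBB, neg_zero]
        obtain ⟨y, hy⟩ := hm
        refine ⟨P (r, k - 1 - r) y, hPm _ _, ?_⟩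
        have h3 : P (r + 1, k - r) (D (Db y)) = D (Db (P (r, k - 1 - r) y)) := by
          rw [cD, cDb]
          congr 5 <;> ring
        rw [← h3]
        rw [LinearMap.comp_apply] at hy
        rw [hy, cD, add_sub_cancel_right, hP1 _ _ (hPm _ _)]
      choose g hgA hg using hγ
      set η := ∑ r ∈ S, g r with hη
      have hPη : ∀ r, P (r, k - 1 - r) η = g r := by
        intro r
        by_cases hr : r ∈ S
        · rw [hη, map_sum, Finset.sum_eq_single r, hP1 _ _ (hgA r)]
          · intro b _ hb
            exact hP0 _ _ _ (hgA b) (fun hh => hb (congrArg Prod.fst hh))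
          · exact fun hh => absurd hr hh
        · have h1 := hgA r
          have h2 := hPm (r, k - 1 - r) η
          rw [hS _ _ hr, Submodule.mem_bot] at h1 h2
          rw [h1, h2]
      have hdη : (D + Db) η ∈ Ak A k := by
        rw [hη, map_sum]
        refine Submodule.sum_mem _ fun r _ => Submodule.add_mem _ (hAk k (r + 1) _ ?_) (hAk k r _ ?_)
        · have := hDm _ _ (hgA r)
          convert this using 2
          ext <;> simp <;> ring
        · have := hDbm _ _ (hgA r)
          convert this using 2
          ext <;> simp <;> ring
      have hdd : (D + Db) ((D + Db) η) = 0 := by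
        simp [hDD, hBB, hDB]
      set β := α - (D + Db) η with hβ
      have hβA : β ∈ Ak A k := Submodule.sub_mem _ hα.2 hdη
      have hPβ : ∀ r, P (r, k - r) β = P (r, k - r) α - (D (g (r - 1)) + Db (g r)) := by
        intro r
        rw [hβ, map_sub, LinearMap.add_apply, map_add, cD, cDb, ← hPη r, ← hPη (r - 1)]
        congr 6 <;> ring_nf
      have hβk : ∀ r, P (r, k - r) β ∈ ker D ⊓ ker Db ⊓ A (r, k - r) := by
        intro r
        refine ⟨⟨?_, ?_⟩, hPm _ _⟩
        · rw [SetLike.mem_coe, LinearMap.mem_ker, hPβ, map_sub, map_add, hDD, hg, zero_add, sub_self]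
        · rw [SetLike.mem_coe, LinearMap.mem_ker, hPβ, map_sub, map_add, hBB, hDB, hg, add_zero, sub_neg_eq_add,
            add_comm]
          exact hcl r
      have hβZ : ∀ r, P (r, k - r) β ∈ Zd A D Db k := fun r => by
        refine ⟨?_, hAk k r _ (hPm _ _)⟩
        have h1 : D (P (r, k - r) β) = 0 := (hβk r).1.1
        have h2 : Db (P (r, k - r) β) = 0 := (hβk r).1.2
        rw [SetLike.mem_coe, LinearMap.mem_ker, LinearMap.add_apply, h1, h2, add_zero]
      have hfin : (BdZ A D Db k).mkQ ⟨α, hα⟩ =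
          ∑ r ∈ S, (BdZ A D Db k).mkQ ⟨P (r, k - r) β, hβZ r⟩ := by
        rw [← map_sum, Submodule.mkQ_apply, Submodule.mkQ_apply, Submodule.Quotient.eq]
        have hv : ((⟨α, hα⟩ - ∑ r ∈ S, ⟨P (r, k - r) β, hβZ r⟩ : Zd A D Db k) : V)
            = (D + Db) η := by
          rw [Submodule.coe_sub, Submodule.coe_sum]
          simp only
          rw [bc_sum hP1 hP0 S hS k β hβA, hβ, sub_sub_cancel]
        rw [Submodule.mem_comap, Submodule.subtype_apply, hv]
        exact ⟨⟨η, rfl⟩, hdη⟩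
      rw [hfin]
      exact Submodule.sum_mem _ fun r _ => Submodule.mem_iSup_of_mem r
        (Submodule.mem_map_of_mem (hβk r))
end

section
/- Let (A^{p,q}, ∂, ∂̄) be a bounded double complex of complex vector spaces satisfying the ∂∂̄-lemma, and let p ≤ k be integers. If σ ∈ F^p A^k satisfies dσ = 0, then there exist x ∈ A^{k−1} and, for each r ≥ p, elements β^{r,k−r} ∈ A^{r,k−r} with dβ^{r,k−r} = 0, such that σ = dx + Σ_{r≥p} β^{r,k−r}. -/
/-!
STATEMENT 4: For a bounded double complex `(A^{p,q}, ∂, ∂̄)` of complex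
vector spaces satisfying the ∂∂̄-lemma, and integers `p ≤ k`: if
`σ ∈ F^p A^k` satisfies `dσ = 0`, then there exist `x ∈ A^{k-1}` and
`d`-closed `β^{r,k-r} ∈ A^{r,k-r}` for each `r ≥ p` with
`σ = dx + Σ_{r≥p} β^{r,k-r}`.
-/

open LinearMap Submodule

variable {V : Type*} [AddCommGroup V] [Module ℂ V]

/-- The Hodge filtration at the level of forms:
`F^p A^k = ⊕_{r ≥ p} A^{r,k-r}`. -/
def FpA (A : ℤ × ℤ → Submodule ℂ V) (p k : ℤ) : Submodule ℂ V :=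
  ⨆ r : ℤ, ⨆ _ : p ≤ r, A (r, k - r)

theorem aux_FpA_succ (A : ℤ × ℤ → Submodule ℂ V) (p k : ℤ) :
    FpA A p k ≤ A (p, k - p) ⊔ FpA A (p + 1) k := by
  refine iSup₂_le fun r hr => ?_
  rcases eq_or_lt_of_le hr with rfl | h
  · exact le_sup_left
  · exact le_trans (le_iSup₂_of_le (f := fun r (_ : p + 1 ≤ r) => A (r, k - r)) r
      (by omega) le_rfl) le_sup_right

theorem aux_mem_FpA (A : ℤ × ℤ → Submodule ℂ V) {p k r s : ℤ} (hr : p ≤ r) (hs : s = k - r)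
    {v : V} (hv : v ∈ A (r, s)) : v ∈ FpA A p k := by
  subst hs
  exact (le_iSup₂_of_le (f := fun r (_ : p ≤ r) => A (r, k - r)) r hr le_rfl) hv

theorem aux_map_FpA (A : ℤ × ℤ → Submodule ℂ V) (D Db : V →ₗ[ℂ] V)
    (hc : IsBoundedDoubleComplex A D Db) (p k : ℤ) {v : V} (hv : v ∈ FpA A p k) :
    (D + Db) v ∈ FpA A p (k + 1) := by
  have : FpA A p k ≤ (FpA A p (k + 1)).comap (D + Db) := by
    refine iSup₂_le fun r hr w hw => ?_
    rw [Submodule.mem_comap, LinearMap.add_apply]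
    refine add_mem ?_ ?_
    · exact aux_mem_FpA A (r := r + 1) (s := k - r) (by omega) (by ring)
        (hc.mapD _ _ (Submodule.mem_map_of_mem hw))
    · exact aux_mem_FpA A (r := r) (s := k - r + 1) (by omega) (by ring)
        (hc.mapDb _ _ (Submodule.mem_map_of_mem hw))
  exact this hv

theorem aux_main
    (A : ℤ × ℤ → Submodule ℂ V) (D Db : V →ₗ[ℂ] V)
    (hc : IsBoundedDoubleComplex A D Db)
    (hlem : ker D ⊓ ker Db ⊓ (range D ⊔ range Db) = range (D ∘ₗ Db))
    (p k : ℤ) (σ : V) (hσ : σ ∈ FpA A p k) (hdσ : (D + Db) σ = 0) :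
    ∃ y ∈ A (p, k - p - 1), ∃ b ∈ A (p, k - p), (D + Db) b = 0 ∧
      σ - (D + Db) y - b ∈ FpA A (p + 1) k := by
  have hind := hc.internal.submodule_iSupIndep
  have htop := hc.internal.submodule_iSup_eq_top
  have hDD : ∀ v, D (D v) = 0 := fun v => LinearMap.congr_fun hc.ddzero v
  have hBB : ∀ v, Db (Db v) = 0 := fun v => LinearMap.congr_fun hc.dbdbzero v
  have hac : ∀ v, D (Db v) + Db (D v) = 0 := fun v => LinearMap.congr_fun hc.anticomm v
  obtain ⟨s, hs, s', hs', rfl⟩ := Submodule.mem_sup.1 (aux_FpA_succ A p k hσ)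
  have hDs : D s ∈ A (p + 1, k - p) := hc.mapD _ _ (Submodule.mem_map_of_mem hs)
  have hBs : Db s ∈ A (p, k - p + 1) := hc.mapDb _ _ (Submodule.mem_map_of_mem hs)
  have h0 : Db s = 0 := by
    refine Submodule.disjoint_def.1 (hind (p, k - p + 1)) _ hBs ?_
    have h1 : Db s = -(D s + (D + Db) s') := by
      rw [eq_neg_iff_add_eq_zero, ← hdσ]; simp only [LinearMap.add_apply, map_add]; abel
    have h2 : Db s ∈ FpA A (p + 1) (k + 1) := by
      rw [h1]
      exact neg_mem (add_mem (aux_mem_FpA A le_rfl (by ring) hDs) (aux_map_FpA A D Db hc _ _ hs'))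
    refine (iSup₂_le fun r hr => ?_ : FpA A (p + 1) (k + 1) ≤ _) h2
    refine le_iSup₂_of_le (f := fun j (_ : j ≠ (p, k - p + 1)) => A j) (r, k + 1 - r) ?_ le_rfl
    intro h
    have := congrArg Prod.fst h
    simp at this
    omega
  have h3 : D s ∈ range (D ∘ₗ Db) := by
    rw [← hlem]
    refine ⟨⟨hDD s, ?_⟩, Submodule.mem_sup_left ⟨s, rfl⟩⟩
    have := hac s
    rw [h0, map_zero, zero_add] at this
    exact this
  obtain ⟨y, hy⟩ := h3
  have hytop : y ∈ A (p, k - p - 1) ⊔ ⨆ j, ⨆ _ : j ≠ (p, k - p - 1), A j := by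
    have : (⊤ : Submodule ℂ V) ≤ A (p, k - p - 1) ⊔ ⨆ j, ⨆ _ : j ≠ (p, k - p - 1), A j := by
      rw [← htop]
      refine iSup_le fun j => ?_
      by_cases h : j = (p, k - p - 1)
      · rw [h]; exact le_sup_left
      · exact le_trans (le_iSup₂_of_le (f := fun j (_ : j ≠ (p, k - p - 1)) => A j) j h le_rfl)
          le_sup_right
    exact this trivial
  obtain ⟨y0, hy0, y1, hy1, rfl⟩ := Submodule.mem_sup.1 hytop
  have hBy0 : Db y0 ∈ A (p, k - p) := by
    have := hc.mapDb _ _ (Submodule.mem_map_of_mem hy0)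
    rwa [sub_add_cancel] at this
  have hDBy0 : D (Db y0) ∈ A (p + 1, k - p) := hc.mapD _ _ (Submodule.mem_map_of_mem hBy0)
  have h4 : D s - D (Db y0) = 0 := by
    refine Submodule.disjoint_def.1 (hind (p + 1, k - p)) _ (sub_mem hDs hDBy0) ?_
    have h5 : D s - D (Db y0) = D (Db y1) := by
      rw [← hy]; simp
    rw [h5]
    have : (⨆ j, ⨆ _ : j ≠ (p, k - p - 1), A j) ≤
        (⨆ j, ⨆ _ : j ≠ (p + 1, k - p), A j).comap (D ∘ₗ Db) := by
      refine iSup₂_le fun j hj w hw => ?_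
      obtain ⟨a, b⟩ := j
      have hw2 : D (Db w) ∈ A (a + 1, b + 1) := hc.mapD _ _ (Submodule.mem_map_of_mem
        (hc.mapDb _ _ (Submodule.mem_map_of_mem hw)))
      refine (le_iSup₂_of_le (f := fun j (_ : j ≠ (p + 1, k - p)) => A j) (a + 1, b + 1) ?_
        le_rfl) hw2
      intro h
      apply hj
      simp only [Prod.mk.injEq] at h ⊢
      omega
    exact this hy1
  refine ⟨y0, hy0, s - Db y0, sub_mem hs hBy0, ?_, ?_⟩
  · simp only [LinearMap.add_apply, map_sub, h0, hBB]
    simpa using h4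
  · have : s + s' - (D + Db) y0 - (s - Db y0) = s' - D y0 := by
      simp only [LinearMap.add_apply]; abel
    rw [this]
    exact sub_mem hs' (aux_mem_FpA A (r := p + 1) (s := k - p - 1) le_rfl (by ring)
      (hc.mapD _ _ (Submodule.mem_map_of_mem hy0)))

theorem aux_finsupp (A : ℤ × ℤ → Submodule ℂ V) (D Db : V →ₗ[ℂ] V)
    (hc : IsBoundedDoubleComplex A D Db) (k : ℤ) (β : ℤ → V) (hβ : ∀ r, β r ∈ A (r, k - r)) :
    (Function.support β).Finite := by
  refine (hc.bounded.image Prod.fst).subset fun r hr => ⟨(r, k - r), ?_, rfl⟩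
  intro h
  apply hr
  have := hβ r
  rw [h] at this
  simpa using this

theorem aux_bound (A : ℤ × ℤ → Submodule ℂ V) (D Db : V →ₗ[ℂ] V)
    (hc : IsBoundedDoubleComplex A D Db) (k : ℤ) : ∃ N : ℤ, ∀ p, N ≤ p → FpA A p k = ⊥ := by
  obtain ⟨M, hM⟩ := (hc.bounded.image Prod.fst).bddAbove
  refine ⟨M + 1, fun p hp => ?_⟩
  refine le_bot_iff.1 (iSup₂_le fun r hr => le_bot_iff.2 ?_)
  by_contra h
  have : r ≤ M := hM ⟨(r, k - r), h, rfl⟩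
  omega

theorem aux_ind
    (A : ℤ × ℤ → Submodule ℂ V) (D Db : V →ₗ[ℂ] V)
    (hc : IsBoundedDoubleComplex A D Db)
    (hlem : ker D ⊓ ker Db ⊓ (range D ⊔ range Db) = range (D ∘ₗ Db))
    (k N : ℤ) (hN : ∀ p, N ≤ p → FpA A p k = ⊥) (n : ℕ) : ∀ (p : ℤ) (_ : N ≤ p + n)
    (σ : V) (_ : σ ∈ FpA A p k) (_ : (D + Db) σ = 0),
    ∃ x : V, ∃ β : ℤ → V, x ∈ Ak A (k - 1) ∧
      (∀ r : ℤ, β r ∈ A (r, k - r)) ∧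
      (∀ r : ℤ, (D + Db) (β r) = 0) ∧
      (∀ r : ℤ, r < p → β r = 0) ∧
      σ = (D + Db) x + ∑ᶠ r : ℤ, β r := by
  induction n with
  | zero =>
    intro p hp σ hσ _
    rw [hN p (by simpa using hp)] at hσ
    have : σ = 0 := by simpa using hσ
    subst this
    exact ⟨0, fun _ => 0, zero_mem _, fun _ => zero_mem _, fun _ => map_zero _, fun _ _ => rfl,
      by simp⟩
  | succ n ih =>
    intro p hp σ hσ hdσ
    obtain ⟨y, hy, b, hb, hdb, hF⟩ := aux_main A D Db hc hlem p k σ hσ hdσ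
    have hdd : (D + Db) ((D + Db) y) = 0 := by
      have h1 : D (D y) = 0 := LinearMap.congr_fun hc.ddzero y
      have h2 : Db (Db y) = 0 := LinearMap.congr_fun hc.dbdbzero y
      have h3 : D (Db y) + Db (D y) = 0 := LinearMap.congr_fun hc.anticomm y
      simp only [LinearMap.add_apply, map_add, h1, h2, zero_add, add_zero]
      rw [add_comm]; exact h3
    obtain ⟨x, β, hx, hβ, hdβ, hβ0, he⟩ := ih (p + 1) (by push_cast at hp; omega) _ hF
      (by rw [map_sub, map_sub, hdσ, hdd, hdb]; simp)
    have hS : ∀ r, (Pi.single p b : ℤ → V) r ∈ A (r, k - r) := by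
      intro r
      by_cases h : r = p
      · subst h; simpa using hb
      · simp [h]
    refine ⟨x + y, fun r => β r + (Pi.single p b : ℤ → V) r, add_mem hx ?_,
      fun r => add_mem (hβ r) (hS r), ?_, ?_, ?_⟩
    · refine (le_iSup (fun r => A (r, k - 1 - r)) p) ?_
      rwa [sub_right_comm] at hy
    · intro r
      rw [map_add, hdβ, zero_add]
      by_cases h : r = p
      · subst h; simpa using hdb
      · simp [h]
    · intro r hr
      simp [hβ0 r (by omega), hr.ne]
    · rw [finsum_add_distrib (aux_finsupp A D Db hc k _ hβ) (aux_finsupp A D Db hc k _ hS),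
        finsum_eq_single (Pi.single p b : ℤ → V) p (fun r hr => by simp [hr]), Pi.single_eq_same,
        map_add]
      have : σ = (σ - (D + Db) y - b) + (D + Db) y + b := by abel
      rw [this, he]
      abel

theorem dclosed_filtered_decomposition
    (A : ℤ × ℤ → Submodule ℂ V) (D Db : V →ₗ[ℂ] V)
    (hc : IsBoundedDoubleComplex A D Db)
    (hlem : ker D ⊓ ker Db ⊓ (range D ⊔ range Db) = range (D ∘ₗ Db))
    (p k : ℤ) (hpk : p ≤ k)
    (σ : V) (hσ : σ ∈ FpA A p k) (hdσ : (D + Db) σ = 0) :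
    ∃ x : V, ∃ β : ℤ → V, x ∈ Ak A (k - 1) ∧
      (∀ r : ℤ, β r ∈ A (r, k - r)) ∧
      (∀ r : ℤ, (D + Db) (β r) = 0) ∧
      (∀ r : ℤ, r < p → β r = 0) ∧
      σ = (D + Db) x + ∑ᶠ r : ℤ, β r := by
  obtain ⟨N, hN⟩ := aux_bound A D Db hc k
  exact aux_ind A D Db hc hlem k N hN (N - p).toNat p (by omega) σ hσ hdσ
end

section
/- Let (A^{p,q}, ∂, ∂̄) be a bounded double complex of complex vector spaces satisfying the ∂∂̄-lemma. Let z ∈ A^{p,q} and y ∈ A^{p+1,q−1} satisfy ∂y = 0, ∂̄z = 0 and ∂z = ∂̄y. Then there exist u ∈ A^{p,q−1}, τ ∈ A^{p,q} with dτ = 0, and μ ∈ A^{p+1,q−1} with dμ = 0, such that z = ∂̄u + τ and y = −∂u + μ. -/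
/-!
STATEMENT 6: For a bounded double complex `(A^{p,q}, ∂, ∂̄)` of complex
vector spaces satisfying the ∂∂̄-lemma: if `z ∈ A^{p,q}` and
`y ∈ A^{p+1,q-1}` satisfy `∂y = 0`, `∂̄z = 0` and `∂z = ∂̄y`, then there
exist `u ∈ A^{p,q-1}`, a `d`-closed `τ ∈ A^{p,q}` and a `d`-closed
`μ ∈ A^{p+1,q-1}` with `z = ∂̄u + τ` and `y = -∂u + μ`.
-/

open LinearMap Submodule

theorem transversality_key_step
    {V : Type*} [AddCommGroup V] [Module ℂ V]
    (A : ℤ × ℤ → Submodule ℂ V) (D Db : V →ₗ[ℂ] V)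
    (hc : IsBoundedDoubleComplex A D Db)
    (hlem : ker D ⊓ ker Db ⊓ (range D ⊔ range Db) = range (D ∘ₗ Db))
    (p q : ℤ) (z y : V)
    (hz : z ∈ A (p, q)) (hy : y ∈ A (p + 1, q - 1))
    (hDy : D y = 0) (hDbz : Db z = 0) (hDz : D z = Db y) :
    ∃ u ∈ A (p, q - 1), ∃ τ ∈ A (p, q), ∃ μ ∈ A (p + 1, q - 1),
      (D + Db) τ = 0 ∧ (D + Db) μ = 0 ∧ z = Db u + τ ∧ y = -(D u) + μ := by
  classical
  letI : DirectSum.Decomposition A := hc.internal.chooseDecomposition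
  have hanti : ∀ x, D (Db x) + Db (D x) = 0 := fun x => by
    simpa using LinearMap.congr_fun hc.anticomm x
  have hdd : ∀ x, D (D x) = 0 := fun x => by
    simpa using LinearMap.congr_fun hc.ddzero x
  have hbb : ∀ x, Db (Db x) = 0 := fun x => by
    simpa using LinearMap.congr_fun hc.dbdbzero x
  have hD : ∀ (a b : ℤ) (x : V), x ∈ A (a, b) → D x ∈ A (a + 1, b) := fun a b x hx =>
    hc.mapD a b (Submodule.mem_map_of_mem hx)
  have hDb : ∀ (a b : ℤ) (x : V), x ∈ A (a, b) → Db x ∈ A (a, b + 1) := fun a b x hx =>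
    hc.mapDb a b (Submodule.mem_map_of_mem hx)
  have hmem : D z ∈ range (D ∘ₗ Db) := by
    rw [← hlem]
    refine ⟨⟨?_, ?_⟩, Submodule.mem_sup_left ⟨z, rfl⟩⟩
    · exact hdd z
    · have h := hanti z
      rw [hDbz, map_zero, zero_add] at h
      exact h
  obtain ⟨v, hv⟩ := hmem
  -- `∂∂̄` commutes with taking homogeneous components
  have hproj : ∀ (a b : ℤ) (w : V),
      ((DirectSum.decompose A (D (Db w)) (a + 1, b + 1) : A (a + 1, b + 1)) : V)
        = D (Db ((DirectSum.decompose A w (a, b) : A (a, b)) : V)) := by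
    intro a b w
    induction w using DirectSum.Decomposition.inductionOn A with
    | zero => simp
    | @homogeneous i m =>
      obtain ⟨c, e⟩ := i
      have h2 : D (Db (m : V)) ∈ A (c + 1, e + 1) := hD _ _ _ (hDb _ _ _ m.2)
      by_cases h : (c, e) = (a, b)
      · obtain ⟨rfl, rfl⟩ := Prod.mk.inj h
        rw [DirectSum.decompose_of_mem_same A h2, DirectSum.decompose_of_mem_same A m.2]
      · have h' : (c + 1, e + 1) ≠ (a + 1, b + 1) := by
          intro h3
          apply h
          simpa using h3
        rw [DirectSum.decompose_of_mem_ne A h2 h', DirectSum.decompose_of_mem_ne A m.2 h]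
        simp
    | add m n hm hn =>
      simp only [map_add, DirectSum.decompose_add, DirectSum.add_apply, Submodule.coe_add, hm, hn]
  obtain ⟨u, hu, huz⟩ : ∃ u ∈ A (p, q - 1), D (Db u) = D z := by
    refine ⟨_, (DirectSum.decompose A v (p, q - 1)).2, ?_⟩
    rw [← hproj p (q - 1) v]
    have h1 : D (Db v) = D z := hv
    have h2 : D z ∈ A (p + 1, q - 1 + 1) := by
      rw [sub_add_cancel]
      exact hD _ _ _ hz
    rw [h1, DirectSum.decompose_of_mem_same A h2]
  have hDbu : Db u ∈ A (p, q) := by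
    have h := hDb _ _ _ hu
    rwa [sub_add_cancel] at h
  have hbd : Db (D u) = -(D z) := by
    rw [← huz]
    exact eq_neg_of_add_eq_zero_right (hanti u)
  refine ⟨u, hu, z - Db u, sub_mem hz hDbu, y + D u, add_mem hy (hD _ _ _ hu), ?_, ?_, ?_, ?_⟩
  · simp [hDbz, hbb, huz]
  · simp [hDy, hdd, hbd, hDz]
  · abel
  · abel
end

section
/- Let (A^{p,q}, ∂, ∂̄) be a bounded double complex of complex vector spaces, and let p ≤ k be integers. Suppose σ ∈ F^p A^k satisfies dσ = 0 and σ = dx + Σ_{r≥0} β^{r,k−r}, where x ∈ A^{k−1} has bigraded components x^{r,k−1−r} ∈ A^{r,k−1−r} and each β^{r,k−r} ∈ A^{r,k−r} satisfies dβ^{r,k−r} = 0. Then σ = d(Σ_{r≥p+1} x^{r−1,k−r}) + ∂x^{p−1,k−p} + Σ_{r≥p} β^{r,k−r}, and in particular ∂x^{p−1,k−p} ∈ A^{p,k−p} satisfies d(∂x^{p−1,k−p}) = 0; if moreover the double complex satisfies the ∂∂̄-lemma, then ∂x^{p−1,k−p} ∈ im(∂∂̄). -/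
/-!
STATEMENT 7: For a bounded double complex `(A^{p,q}, ∂, ∂̄)` and integers
`p ≤ k`: suppose `σ ∈ F^p A^k` satisfies `dσ = 0` and
`σ = dx + Σ_{r≥0} β^{r,k-r}` where `x ∈ A^{k-1}` has bigraded components
`x^{r,k-1-r}` and each `β^{r,k-r} ∈ A^{r,k-r}` is `d`-closed.  Then
`σ = d(Σ_{r≥p+1} x^{r-1,k-r}) + ∂x^{p-1,k-p} + Σ_{r≥p} β^{r,k-r}`; in
particular `∂x^{p-1,k-p} ∈ A^{p,k-p}` and `d(∂x^{p-1,k-p}) = 0`; if moreover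
the ∂∂̄-lemma holds then `∂x^{p-1,k-p} ∈ im(∂∂̄)`.
-/

open LinearMap Submodule

variable {V : Type*} [AddCommGroup V] [Module ℂ V]

/-- Splitting a finitely supported sum over `ℤ` at `p`. -/
lemma finsum_split_at {W : Type*} [AddCommGroup W] (f : ℤ → W) (hf : f.support.Finite) (p : ℤ) :
    ∑ᶠ r : ℤ, f r = (∑ᶠ (r : ℤ) (_ : p ≤ r), f r) + ∑ᶠ (r : ℤ) (_ : r < p), f r := by
  have h := finsum_mem_union' (f := f) (s := Set.Ici p) (t := Set.Iio p)
    (by rw [Set.disjoint_left]; intro a ha hb; simp at ha hb; omega)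
    (hf.subset Set.inter_subset_right) (hf.subset Set.inter_subset_right)
  have hu : Set.Ici p ∪ Set.Iio p = Set.univ := by
    ext a; simp
  rw [hu, finsum_mem_univ] at h
  simpa using h

lemma finsum_lt_mem {V : Type*} [AddCommGroup V] [Module ℂ V] (S : Submodule ℂ V)
    (P : ℤ → Prop) (f : ℤ → V) (h : ∀ r, P r → f r ∈ S) :
    ∑ᶠ (r : ℤ) (_ : P r), f r ∈ S := by
  refine finsum_induction (· ∈ S) S.zero_mem (fun _ _ => S.add_mem) fun r => ?_
  exact finsum_induction (· ∈ S) S.zero_mem (fun _ _ => S.add_mem) fun hr => h r hr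

theorem rearrangement_identity
    (A : ℤ × ℤ → Submodule ℂ V) (D Db : V →ₗ[ℂ] V)
    (hc : IsBoundedDoubleComplex A D Db)
    (p k : ℤ) (hpk : p ≤ k)
    (σ : V) (x β : ℤ → V)
    (hσ : σ ∈ FpA A p k) (hdσ : (D + Db) σ = 0)
    (hx : ∀ r : ℤ, x r ∈ A (r, k - 1 - r))
    (hβ : ∀ r : ℤ, β r ∈ A (r, k - r))
    (hdβ : ∀ r : ℤ, (D + Db) (β r) = 0)
    (hdecomp : σ = (D + Db) (∑ᶠ r : ℤ, x r) + ∑ᶠ r : ℤ, β r) :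
    σ = (D + Db) (∑ᶠ (r : ℤ) (_ : p + 1 ≤ r), x (r - 1)) + D (x (p - 1))
        + ∑ᶠ (r : ℤ) (_ : p ≤ r), β r ∧
    D (x (p - 1)) ∈ A (p, k - p) ∧
    (D + Db) (D (x (p - 1))) = 0 ∧
    (ker D ⊓ ker Db ⊓ (range D ⊔ range Db) = range (D ∘ₗ Db) →
      D (x (p - 1)) ∈ range (D ∘ₗ Db)) := by
  have hfin : ∀ (c : ℤ) (f : ℤ → V), (∀ r, f r ∈ A (r, c - r)) → f.support.Finite := by
    intro c f hf
    have hinj : Function.Injective (fun r : ℤ => ((r, c - r) : ℤ × ℤ)) := by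
      intro a b hab
      exact congrArg Prod.fst hab
    refine (hc.bounded.preimage (f := fun r : ℤ => ((r, c - r) : ℤ × ℤ)) hinj.injOn).subset ?_
    intro r hr hbot
    have h := hf r
    rw [hbot, Submodule.mem_bot] at h
    exact hr h
  have hDx : ∀ r, D (x r) ∈ A (r + 1, k - (r + 1)) := by
    intro r
    have h := hc.mapD _ _ (Submodule.mem_map_of_mem (hx r))
    rwa [show k - 1 - r = k - (r + 1) by ring] at h
  have hDbx : ∀ r, Db (x r) ∈ A (r, k - r) := by
    intro r
    have h := hc.mapDb _ _ (Submodule.mem_map_of_mem (hx r))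
    rwa [show k - 1 - r + 1 = k - r by ring] at h
  have hDD : ∀ v, D (D v) = 0 := fun v => LinearMap.congr_fun hc.ddzero v
  have hBB : ∀ v, Db (Db v) = 0 := fun v => LinearMap.congr_fun hc.dbdbzero v
  have hDB : ∀ v, D (Db v) + Db (D v) = 0 := fun v => LinearMap.congr_fun hc.anticomm v
  have hdd : ∀ v, (D + Db) ((D + Db) v) = 0 := by
    intro v
    have h := hDB v
    simp only [LinearMap.add_apply, map_add, hDD, hBB]
    simpa [add_comm] using h
  have hmem : D (x (p - 1)) ∈ A (p, k - p) := by
    have h := hDx (p - 1)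
    rwa [show p - 1 + 1 = p by ring] at h
  have hshift : ∑ᶠ (r : ℤ) (_ : p + 1 ≤ r), x (r - 1) = ∑ᶠ (r : ℤ) (_ : p ≤ r), x r := by
    rw [← finsum_comp_equiv (Equiv.subRight (1 : ℤ)) (f := fun r => ∑ᶠ (_ : p ≤ r), x r)]
    refine finsum_congr fun r => ?_
    simp only [Equiv.subRight_apply]
    exact finsum_congr_Prop (propext (by omega)) fun _ => rfl
  have hGmem : ∀ r, p ≤ r → A (r, k - r) ≤ FpA A p k := fun r hr =>
    le_iSup₂_of_le (f := fun (r : ℤ) (_ : p ≤ r) => A (r, k - r)) r hr le_rfl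
  let L : Submodule ℂ V := ⨆ r : ℤ, ⨆ _ : r < p, A (r, k - r)
  have hLmem : ∀ r, r < p → A (r, k - r) ≤ L := fun r hr =>
    le_iSup₂_of_le (f := fun (r : ℤ) (_ : r < p) => A (r, k - r)) r hr le_rfl
  have hdisj : Disjoint (FpA A p k) L := by
    have h := hc.internal.submodule_iSupIndep.disjoint_biSup_biSup
      (s := {a : ℤ × ℤ | p ≤ a.1}) (t := {a : ℤ × ℤ | a.1 < p})
      (by rw [Set.disjoint_left]; intro a ha hb; simp at ha hb; omega)
    refine h.mono ?_ ?_
    · exact iSup₂_le fun r hr =>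
        le_iSup₂_of_le (f := fun (a : ℤ × ℤ) (_ : a ∈ {a : ℤ × ℤ | p ≤ a.1}) => A a)
          (r, k - r) hr le_rfl
    · exact iSup₂_le fun r hr =>
        le_iSup₂_of_le (f := fun (a : ℤ × ℤ) (_ : a ∈ {a : ℤ × ℤ | a.1 < p}) => A a)
          (r, k - r) hr le_rfl
  have hx1 := finsum_split_at x (hfin (k - 1) x hx) p
  have hb1 := finsum_split_at β (hfin k β hβ) p
  have hxl : ∑ᶠ (r : ℤ) (_ : r < p), x r = x (p - 1) + ∑ᶠ (r : ℤ) (_ : r < p - 1), x r := by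
    have hs := hfin (k - 1) x hx
    have h := finsum_mem_insert' (f := x) (a := p - 1) (s := Set.Iio (p - 1))
      (by simp) (hs.subset Set.inter_subset_right)
    have hu : insert (p - 1) (Set.Iio (p - 1)) = Set.Iio p := by
      ext a; simp only [Set.mem_insert_iff, Set.mem_Iio]; omega
    rw [hu] at h
    simpa [add_comm] using h
  have hid : σ = (D + Db) (∑ᶠ (r : ℤ) (_ : p + 1 ≤ r), x (r - 1)) + D (x (p - 1))
        + ∑ᶠ (r : ℤ) (_ : p ≤ r), β r := by
    rw [hshift]
    rw [hx1, hb1, hxl] at hdecomp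
    have hA : (D + Db) (∑ᶠ (r : ℤ) (_ : p ≤ r), x r) ∈ FpA A p k := by
      rw [← Submodule.mem_comap]
      refine finsum_lt_mem _ _ _ fun r hr => ?_
      rw [Submodule.mem_comap, LinearMap.add_apply]
      exact add_mem (hGmem _ (by omega) (hDx r)) (hGmem _ hr (hDbx r))
    have hB : (D + Db) (∑ᶠ (r : ℤ) (_ : r < p - 1), x r) ∈ L := by
      rw [← Submodule.mem_comap]
      refine finsum_lt_mem _ _ _ fun r hr => ?_
      rw [Submodule.mem_comap, LinearMap.add_apply]
      exact add_mem (hLmem _ (by omega) (hDx r)) (hLmem _ (by omega) (hDbx r))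
    have hC : ∑ᶠ (r : ℤ) (_ : p ≤ r), β r ∈ FpA A p k :=
      finsum_lt_mem _ _ _ fun r hr => hGmem r hr (hβ r)
    have hE : ∑ᶠ (r : ℤ) (_ : r < p), β r ∈ L :=
      finsum_lt_mem _ _ _ fun r hr => hLmem r hr (hβ r)
    have hF : Db (x (p - 1)) ∈ L := hLmem _ (by omega) (hDbx _)
    have hG : D (x (p - 1)) ∈ FpA A p k := hGmem p le_rfl hmem
    rw [← sub_eq_zero]
    refine Submodule.disjoint_def.mp hdisj _ (sub_mem hσ (add_mem (add_mem hA hG) hC)) ?_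
    have hy := add_mem (add_mem hB hF) hE
    convert hy using 1
    rw [hdecomp, map_add, map_add, LinearMap.add_apply D Db (x (p - 1))]
    abel
  have hclosed : (D + Db) (D (x (p - 1))) = 0 := by
    have hz : (D + Db) (∑ᶠ (r : ℤ) (_ : p ≤ r), β r) = 0 := by
      rw [← LinearMap.mem_ker]
      exact finsum_lt_mem _ _ _ fun r _ => hdβ r
    have h := hdσ
    rw [hid, map_add, map_add, hdd, hz] at h
    simpa [add_comm] using h
  refine ⟨hid, hmem, hclosed, fun hdd' => ?_⟩
  rw [← hdd']
  refine ⟨⟨hDD _, ?_⟩, Submodule.mem_sup_left ⟨_, rfl⟩⟩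
  rw [LinearMap.add_apply, hDD, zero_add] at hclosed
  exact hclosed
end

section
/- Let (A^{p,q}, ∂, ∂̄) be a bounded double complex of complex vector spaces satisfying the ∂∂̄-lemma. Then for every p, q the natural surjection H^{p,q}_{BC}(A) → H^{p,q}_d(A), induced by the inclusion im(∂∂̄) ∩ A^{p,q} ⊆ im d ∩ A^{p,q}, is an isomorphism; equivalently, every element of A^{p,q} that is both d-closed and d-exact (with the primitive allowed to be an arbitrary element of A^{p+q−1}) lies in im(∂∂̄). -/
/-!
STATEMENT 8: For a bounded double complex `(A^{p,q}, ∂, ∂̄)` of complex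
vector spaces satisfying the ∂∂̄-lemma, the natural surjection
`H^{p,q}_{BC}(A) → H^{p,q}_d(A)` is an isomorphism for every `p, q`;
equivalently, every element of `A^{p,q}` that is both `d`-closed and
`d`-exact (with the primitive allowed to be an arbitrary element of
`A^{p+q-1}`) lies in `im(∂∂̄)`.
-/

open LinearMap Submodule

variable {V : Type*} [AddCommGroup V] [Module ℂ V]

theorem bc_to_pureType_deRham_iso
    (A : ℤ × ℤ → Submodule ℂ V) (D Db : V →ₗ[ℂ] V)
    (hc : IsBoundedDoubleComplex A D Db)
    (hlem : ker D ⊓ ker Db ⊓ (range D ⊔ range Db) = range (D ∘ₗ Db))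
    (p q : ℤ) (z : V) (hz : z ∈ A (p, q))
    (hclosed : (D + Db) z = 0)
    (hexact : ∃ x ∈ Ak A (p + q - 1), (D + Db) x = z) :
    z ∈ range (D ∘ₗ Db) := by
  obtain ⟨x, -, hx⟩ := hexact
  have h1 : D z ∈ A (p + 1, q) := hc.mapD p q (Submodule.mem_map_of_mem hz)
  have h2 : Db z ∈ A (p, q + 1) := hc.mapDb p q (Submodule.mem_map_of_mem hz)
  have hsum : D z + Db z = 0 := by simpa using hclosed
  have hne : ((p + 1, q) : ℤ × ℤ) ≠ (p, q + 1) := by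
    intro h
    have := congrArg Prod.fst h
    simp at this
  have hdis : Disjoint (A (p + 1, q)) (A (p, q + 1)) :=
    hc.internal.submodule_iSupIndep.pairwiseDisjoint hne
  have hD : D z = 0 := by
    refine Submodule.disjoint_def.1 hdis _ h1 ?_
    rw [eq_neg_of_add_eq_zero_left hsum]
    exact Submodule.neg_mem _ h2
  have hDb : Db z = 0 := by simpa [hD] using hsum
  rw [← hlem]
  refine ⟨⟨hD, hDb⟩, ?_⟩
  rw [← hx]
  exact Submodule.add_mem_sup ⟨x, rfl⟩ ⟨x, rfl⟩
end
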